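/- Let G = (V,E) be a computation graph on a nonempty vertex set with work : V → ℝ≥0, size_out : V → ℝ≥0, B > 0, let k ≥ 1, and let L = max( max_{v ∈ V} work(v), (1/k)·Σ_{v ∈ V} work(v) ). For j ∈ {1,…,k}, define LB_j as the minimum, over all DAG-respecting 3-partitions g : V → {1,2,3} such that Σ_{v : g(v)=2} work(v) ≥ L, such that block 1 is empty if j = 1, and such that block 3 is empty if j = k, of the maximum of: the cost of block 2 under g; (1/(j−1)) times the aggregated cost of superblock {1} under g (taken only when j > 1); and (1/(k−j)) times the aggregated cost of superblock {3} under g (taken only when j < k). Then min_{j ∈ {1,…,k}} LB_j ≤ OPT, the MTPP optimum over DAG-respecting k-partitions. -/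

import Mathlib

open Finset

attribute [local instance] Classical.propDecidable

/-- The edge relation of `E` is acyclic (no directed cycles), i.e. `G` is a DAG. -/
def IsAcyclicRel {V : Type*} (E : Finset (V × V)) : Prop :=
  ∀ v : V, ¬ Relation.TransGen (fun a b : V => (a, b) ∈ E) v v

/-- Total `work` of the nodes assigned to block `b` by the partition `f`. -/
noncomputable def blockWork {V : Type*} [Fintype V] (work : V → NNReal)
    (f : V → ℕ) (b : ℕ) : ℝ :=
  ∑ v ∈ Finset.univ.filter (fun v => f v = b), (work v : ℝ)

/-- Cut cost of block `b` under the partition `f`: `(1/B)` times the sum of `sizeOut u`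
over all nodes `u` having an edge `(u,v) ∈ E` with `f u < b = f v` or `f u = b < f v`,
each such `u` counted once. -/
noncomputable def cutCost {V : Type*} [Fintype V] (E : Finset (V × V)) (sizeOut : V → NNReal)
    (B : NNReal) (f : V → ℕ) (b : ℕ) : ℝ :=
  (1 / (B : ℝ)) * ∑ u ∈ Finset.univ.filter
      (fun u => ∃ v, (u, v) ∈ E ∧ ((f u < b ∧ f v = b) ∨ (f u = b ∧ b < f v))),
    (sizeOut u : ℝ)

/-- Cost of block `b` under `f`: work of the block plus its cut cost. -/
noncomputable def blockCost {V : Type*} [Fintype V] (E : Finset (V × V))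
    (work sizeOut : V → NNReal) (B : NNReal) (f : V → ℕ) (b : ℕ) : ℝ :=
  blockWork work f b + cutCost E sizeOut B f b

/-- Bottleneck cost of a `k`-partition `f`: the maximum block cost over blocks `1,…,k`. -/
noncomputable def bottleneck {V : Type*} [Fintype V] (E : Finset (V × V))
    (work sizeOut : V → NNReal) (B : NNReal) (k : ℕ) (hk : 1 ≤ k) (f : V → ℕ) : ℝ :=
  (Finset.Icc 1 k).sup' (Finset.nonempty_Icc.mpr hk) (blockCost E work sizeOut B f)

/-- The MTPP optimum: minimum bottleneck cost over all DAG-respecting `k`-partitions. -/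
noncomputable def OPT {V : Type*} [Fintype V] (E : Finset (V × V))
    (work sizeOut : V → NNReal) (B : NNReal) (k : ℕ) (hk : 1 ≤ k) : ℝ :=
  sInf {r : ℝ | ∃ f : V → ℕ, (∀ v, f v ∈ Finset.Icc 1 k) ∧ (∀ e ∈ E, f e.1 ≤ f e.2) ∧
    bottleneck E work sizeOut B k hk f = r}

/-- The simple combinatorial lower bound
`L = max(max_v work v, (1/k) Σ_v work v)`. -/
noncomputable def simpleLB {V : Type*} [Fintype V] [Nonempty V]
    (work : V → NNReal) (k : ℕ) : ℝ :=
  max (Finset.univ.sup' Finset.univ_nonempty (fun v => (work v : ℝ)))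
      ((∑ v, (work v : ℝ)) / k)

/-- Aggregated cost of the superblock `S`: total work of the nodes assigned to blocks in `S`
plus `(1/B)` times the sum of `sizeOut u` over nodes `u` having an edge `(u,v) ∈ E` with
exactly one of `f u`, `f v` in `S` (each such `u` counted once). -/
noncomputable def aggCost {V : Type*} [Fintype V] (E : Finset (V × V))
    (work sizeOut : V → NNReal) (B : NNReal) (f : V → ℕ) (S : Finset ℕ) : ℝ :=
  (∑ v ∈ Finset.univ.filter (fun v => f v ∈ S), (work v : ℝ)) +
  (1 / (B : ℝ)) * ∑ u ∈ Finset.univ.filter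
      (fun u => ∃ v, (u, v) ∈ E ∧ ((f u ∈ S ∧ f v ∉ S) ∨ (f u ∉ S ∧ f v ∈ S))),
    (sizeOut u : ℝ)

theorem blockCost_nonneg {V : Type*} [Fintype V] (E : Finset (V × V))
    (work sizeOut : V → NNReal) (B : NNReal) (f : V → ℕ) (b : ℕ) :
    0 ≤ blockCost E work sizeOut B f b := by
  unfold blockCost blockWork cutCost
  positivity

theorem sum_blockWork {V : Type*} [Fintype V] (work : V → NNReal) (f : V → ℕ) (S : Finset ℕ) :
    ∑ b ∈ S, blockWork work f b = ∑ v ∈ univ.filter (fun v => f v ∈ S), (work v : ℝ) := by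
  simp only [blockWork, sum_filter]
  rw [sum_comm]
  simp

/-- The aggregated cost of a superblock is at most the sum of the costs of its blocks. -/
theorem aggCost_le_sum_blockCost {V : Type*} [Fintype V] (E : Finset (V × V))
    (work sizeOut : V → NNReal) (B : NNReal) (f : V → ℕ) (hf : ∀ e ∈ E, f e.1 ≤ f e.2)
    (S : Finset ℕ) :
    aggCost E work sizeOut B f S ≤ ∑ b ∈ S, blockCost E work sizeOut B f b := by
  simp only [aggCost, blockCost, sum_add_distrib, sum_blockWork, cutCost, ← mul_sum]
  gcongr
  simp only [sum_filter]
  rw [sum_comm]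
  refine sum_le_sum fun u _ => ?_
  have hnn : ∀ b ∈ S, (0 : ℝ) ≤
      if ∃ v, (u, v) ∈ E ∧ ((f u < b ∧ f v = b) ∨ (f u = b ∧ b < f v))
        then (sizeOut u : ℝ) else 0 := fun b _ => by split_ifs <;> positivity
  split_ifs with h
  · obtain ⟨v, huv, h⟩ := h
    have hle : f u ≤ f v := hf _ huv
    have hlt : f u < f v := lt_of_le_of_ne hle fun heq => by simp [heq] at h
    rcases h with ⟨hu, -⟩ | ⟨-, hv⟩
    · refine le_trans ?_ (single_le_sum hnn hu)
      rw [if_pos ⟨v, huv, Or.inr ⟨rfl, hlt⟩⟩]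
    · refine le_trans ?_ (single_le_sum hnn hv)
      rw [if_pos ⟨v, huv, Or.inl ⟨hlt, rfl⟩⟩]
  · exact sum_nonneg hnn

theorem aggCost_congr {V : Type*} [Fintype V] (E : Finset (V × V))
    (work sizeOut : V → NNReal) (B : NNReal) {f g : V → ℕ} {S T : Finset ℕ}
    (h : ∀ v, f v ∈ S ↔ g v ∈ T) :
    aggCost E work sizeOut B f S = aggCost E work sizeOut B g T := by
  simp only [aggCost, h]

/-- The cost of a block depends only on which nodes come before, in and after it. -/
theorem blockCost_congr {V : Type*} [Fintype V] (E : Finset (V × V))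
    (work sizeOut : V → NNReal) (B : NNReal) {f g : V → ℕ} {b c : ℕ}
    (hlt : ∀ v, f v < b ↔ g v < c) (heq : ∀ v, f v = b ↔ g v = c)
    (hgt : ∀ v, b < f v ↔ c < g v) :
    blockCost E work sizeOut B f b = blockCost E work sizeOut B g c := by
  simp only [blockCost, blockWork, cutCost, hlt, heq, hgt]

theorem blockCost_le_bottleneck {V : Type*} [Fintype V] (E : Finset (V × V))
    (work sizeOut : V → NNReal) (B : NNReal) {k : ℕ} (hk : 1 ≤ k) (f : V → ℕ) {b : ℕ}
    (hb : b ∈ Icc 1 k) :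
    blockCost E work sizeOut B f b ≤ bottleneck E work sizeOut B k hk f :=
  le_sup' (blockCost E work sizeOut B f) hb

theorem aggCost_div_card_le_bottleneck {V : Type*} [Fintype V] (E : Finset (V × V))
    (work sizeOut : V → NNReal) (B : NNReal) {k : ℕ} (hk : 1 ≤ k) (f : V → ℕ)
    (hf : ∀ e ∈ E, f e.1 ≤ f e.2) {S : Finset ℕ} (hS : S ⊆ Icc 1 k) (hne : S.Nonempty) :
    aggCost E work sizeOut B f S / (S.card : ℝ) ≤ bottleneck E work sizeOut B k hk f := by
  rw [div_le_iff₀ (by exact_mod_cast hne.card_pos), mul_comm, ← nsmul_eq_mul]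
  exact (aggCost_le_sum_blockCost E work sizeOut B f hf S).trans
    (sum_le_card_nsmul _ _ _ fun b hb => blockCost_le_bottleneck E work sizeOut B hk f (hS hb))

/-- Some block of every `k`-partition has work at least `simpleLB`. -/
theorem exists_simpleLB_le_blockWork {V : Type*} [Fintype V] [Nonempty V]
    (work : V → NNReal) {k : ℕ} (hk : 1 ≤ k) (f : V → ℕ) (hf : ∀ v, f v ∈ Icc 1 k) :
    ∃ j ∈ Icc 1 k, simpleLB work k ≤ blockWork work f j := by
  obtain ⟨j, hj, hmax⟩ := exists_max_image (Icc 1 k) (blockWork work f) (nonempty_Icc.mpr hk)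
  refine ⟨j, hj, max_le (sup'_le _ _ fun v _ => ?_) ?_⟩
  · refine le_trans ?_ (hmax (f v) (hf v))
    exact single_le_sum (f := fun v => (work v : ℝ)) (fun _ _ => NNReal.coe_nonneg _)
      (mem_filter.mpr ⟨mem_univ v, rfl⟩)
  · have htotal := sum_blockWork work f (Icc 1 k)
    rw [filter_true_of_mem fun v _ => hf v] at htotal
    rw [div_le_iff₀ (by exact_mod_cast hk), ← htotal, mul_comm, ← nsmul_eq_mul]
    simpa using sum_le_card_nsmul _ _ _ hmax

/-- Merge the blocks before `j` into block `1` and those after `j` into block `3`. -/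
def mergeAround (j n : ℕ) : ℕ := if n < j then 1 else if n = j then 2 else 3

theorem mergeAround_mem (j n : ℕ) : mergeAround j n ∈ Icc 1 3 := by
  unfold mergeAround; split_ifs <;> simp

theorem mergeAround_mono (j : ℕ) : Monotone (mergeAround j) := by
  intro a b h
  unfold mergeAround; split_ifs <;> omega

theorem mergeAround_eq_one {j n : ℕ} : mergeAround j n = 1 ↔ n < j := by
  unfold mergeAround; split_ifs <;> omega

theorem mergeAround_eq_two {j n : ℕ} : mergeAround j n = 2 ↔ n = j := by
  unfold mergeAround; split_ifs <;> omega

theorem mergeAround_eq_three {j n : ℕ} : mergeAround j n = 3 ↔ j < n := by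
  unfold mergeAround; split_ifs <;> omega

theorem mergeAround_lt_two {j n : ℕ} : mergeAround j n < 2 ↔ n < j := by
  unfold mergeAround; split_ifs <;> omega

theorem two_lt_mergeAround {j n : ℕ} : 2 < mergeAround j n ↔ j < n := by
  unfold mergeAround; split_ifs <;> omega

/-- "guess the bottleneck block", Section 3.3: for each guess
`j ∈ {1,…,k}`, `LB j` is the minimum over DAG-respecting `3`-partitions `g` with
`Σ_{g v = 2} work v ≥ L`, with block `1` empty when `j = 1` and block `3` empty when
`j = k`, of the maximum of the cost of block `2`, of `aggCost {1} / (j-1)` (only when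
`j > 1`), and of `aggCost {3} / (k-j)` (only when `j < k`). Then `min_j LB j ≤ OPT`. -/
theorem stmt7 {V : Type*} [Fintype V] [Nonempty V] (E : Finset (V × V))
    (hacyc : IsAcyclicRel E) (work sizeOut : V → NNReal) (B : NNReal) (hB : 0 < B)
    (k : ℕ) (hk : 1 ≤ k)
    (LB : ℕ → ℝ)
    (hLB : ∀ j ∈ Finset.Icc 1 k, LB j =
      sInf {r : ℝ | ∃ g : V → ℕ, (∀ v, g v ∈ Finset.Icc 1 3) ∧
        (∀ e ∈ E, g e.1 ≤ g e.2) ∧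
        simpleLB work k ≤ blockWork work g 2 ∧
        (j = 1 → ∀ v, g v ≠ 1) ∧ (j = k → ∀ v, g v ≠ 3) ∧
        max (blockCost E work sizeOut B g 2)
          (max (if 1 < j then aggCost E work sizeOut B g {1} / ((j - 1 : ℕ) : ℝ) else 0)
               (if j < k then aggCost E work sizeOut B g {3} / ((k - j : ℕ) : ℝ) else 0))
          = r}) :
    sInf {r : ℝ | ∃ j ∈ Finset.Icc 1 k, LB j = r} ≤ OPT E work sizeOut B k hk := by
  refine le_csInf ⟨_, fun _ => 1, fun _ => mem_Icc.mpr ⟨le_rfl, hk⟩, fun _ _ => le_rfl, rfl⟩ ?_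
  rintro _ ⟨f, hf, hE, rfl⟩
  obtain ⟨j, hj, hjL⟩ := exists_simpleLB_le_blockWork work hk f hf
  have hj' := mem_Icc.mp hj
  have hf' := fun v => mem_Icc.mp (hf v)
  have hbdd : BddBelow {r : ℝ | ∃ j ∈ Icc 1 k, LB j = r} :=
    ((Icc 1 k).finite_toSet.image LB).bddBelow
  refine (csInf_le hbdd ⟨j, hj, rfl⟩).trans ?_
  rw [hLB j hj]
  refine csInf_le_of_le ⟨0, ?_⟩ ⟨fun v => mergeAround j (f v), fun v => mergeAround_mem j _,
    fun e he => mergeAround_mono j (hE e he), ?_, ?_, ?_, rfl⟩ ?_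
  · rintro _ ⟨g, -, -, -, -, -, rfl⟩
    exact le_max_of_le_left (blockCost_nonneg E work sizeOut B g 2)
  · simpa only [blockWork, mergeAround_eq_two] using hjL
  · intro h v hv
    have := mergeAround_eq_one.mp hv
    have := hf' v
    omega
  · intro h v hv
    have := mergeAround_eq_three.mp hv
    have := hf' v
    omega
  · have hnn : 0 ≤ bottleneck E work sizeOut B k hk f :=
      (blockCost_nonneg E work sizeOut B f j).trans
        (blockCost_le_bottleneck E work sizeOut B hk f hj)
    refine max_le ?_ (max_le ?_ ?_)
    · rw [blockCost_congr E work sizeOut B (g := f) (c := j) (fun _ => mergeAround_lt_two)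
        (fun _ => mergeAround_eq_two) (fun _ => two_lt_mergeAround)]
      exact blockCost_le_bottleneck E work sizeOut B hk f hj
    · split_ifs with h
      · rw [aggCost_congr E work sizeOut B (g := f) (T := Ico 1 j) fun v => by
          simp [mergeAround_eq_one, hf' v], ← Nat.card_Ico]
        exact aggCost_div_card_le_bottleneck E work sizeOut B hk f hE
          (fun b hb => by simp only [mem_Ico, mem_Icc] at *; omega) (nonempty_Ico.mpr h)
      · exact hnn
    · split_ifs with h
      · rw [aggCost_congr E work sizeOut B (g := f) (T := Ioc j k) fun v => by
          simp [mergeAround_eq_three, hf' v], ← Nat.card_Ioc]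
        exact aggCost_div_card_le_bottleneck E work sizeOut B hk f hE
          (fun b hb => by simp only [mem_Ioc, mem_Icc] at *; omega) (nonempty_Ioc.mpr h)
      · exact hnn
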